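/- Let D be a division ring with center F, and let d₁, d₂ ∈ D be such that the conjugacy classes [d₁] and [d₂] are distinct and d₁ is algebraic over F. Let f(x) ∈ F[x] be the minimal polynomial of d₁ and let S(x) ∈ D[x] be such that f(x) = S(x)·(x − d₁). Set ζ := S(d₂)·d₂·(S(d₂))⁻¹ and d := (d₁ − ζ)·d₁·(d₁ − ζ)⁻¹. Then (x − d₂)(x − d₁) = (x − d)(x − ζ) in D[x]. -/

import Mathlib

open Polynomial

/-- The conjugacy class of `a` in a division ring. -/
def conjClass {D : Type*} [DivisionRing D] (a : D) : Set D :=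
  {b | ∃ d : D, d ≠ 0 ∧ b = d * a * d⁻¹}

theorem conjClass_eq_of_mul_eq {D : Type*} [DivisionRing D] {a b s : D} (hs : s ≠ 0)
    (h : s * b = a * s) : conjClass a = conjClass b := by
  have ha : a = s * b * s⁻¹ := by rw [h, mul_inv_cancel_right₀ hs]
  have hb : b = s⁻¹ * a * s := by rw [mul_assoc, ← h, inv_mul_cancel_left₀ hs]
  ext x
  constructor
  · rintro ⟨c, hc, rfl⟩
    exact ⟨c * s, mul_ne_zero hc hs, by rw [ha, mul_inv_rev]; simp only [mul_assoc]⟩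
  · rintro ⟨c, hc, rfl⟩
    exact ⟨c * s⁻¹, mul_ne_zero hc (inv_ne_zero hs), by
      rw [hb, mul_inv_rev, inv_inv]; simp only [mul_assoc]⟩

theorem eval_mul_C_eq_eval_conj_mul {D : Type*} [DivisionRing D] (P : D[X]) {c : D}
    (hc : c ≠ 0) (b : D) : (P * C c).eval b = P.eval (c * b * c⁻¹) * c := by
  induction P using Polynomial.induction_on' with
  | add p q hp hq => simp only [add_mul, eval_add, hp, hq]
  | monomial n a =>
    rw [monomial_mul_C, eval_monomial, eval_monomial]
    have hpow : c * b ^ n = (c * b * c⁻¹) ^ n * c :=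
      (SemiconjBy.pow_right (show SemiconjBy c b (c * b * c⁻¹) by
        simp [SemiconjBy, hc]) n).eq
    rw [mul_assoc, hpow, ← mul_assoc]

/-- A nonzero polynomial vanishing on a whole conjugacy class can be replaced, without raising
the degree, by a nonzero polynomial with central coefficients. -/
theorem exists_central_annihilator {D : Type*} [DivisionRing D] (a : D) (P : D[X]) (hP : P ≠ 0)
    (hvan : ∀ b ∈ conjClass a, P.eval b = 0) :
    ∃ Q : (Subring.center D)[X], Q ≠ 0 ∧ aeval a Q = 0 ∧ Q.degree ≤ P.degree := by
  induction hn : P.degree using WellFoundedLT.induction generalizing P with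
  | ind n ih =>
  subst hn
  have hlc : P.leadingCoeff ≠ 0 := leadingCoeff_ne_zero.2 hP
  set M : D[X] := C P.leadingCoeff⁻¹ * P with hM
  have hMdeg : M.degree = P.degree := degree_C_mul (inv_ne_zero hlc)
  have hMmonic : M.Monic := by
    rw [Monic, hM, leadingCoeff_mul, leadingCoeff_C, inv_mul_cancel₀ hlc]
  have hMvan : ∀ b ∈ conjClass a, M.eval b = 0 := fun b hb => by
    rw [hM, eval_C_mul, hvan b hb, mul_zero]
  by_cases hcen : ∀ c : D, C c * M = M * C c
  · have hlift : M ∈ lifts (algebraMap (Subring.center D) D) := by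
      rw [lifts_iff_coeff_lifts]
      intro i
      have hi : M.coeff i ∈ Subring.center D := Subring.mem_center_iff.2 fun c => by
        simpa using congrArg (fun p => p.coeff i) (hcen c)
      exact ⟨⟨_, hi⟩, rfl⟩
    obtain ⟨Q, hQ, hQdeg⟩ := exists_degree_eq_of_mem_lifts hlift
    refine ⟨Q, ?_, ?_, (hQdeg.trans hMdeg).le⟩
    · rintro rfl
      exact hMmonic.ne_zero (by rw [← hQ, Polynomial.map_zero])
    · rw [aeval_def, eval₂_eq_eval_map, hQ]
      exact hMvan a ⟨1, one_ne_zero, by simp⟩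
  · push Not at hcen
    obtain ⟨c, hcM⟩ := hcen
    have hc : c ≠ 0 := by
      rintro rfl
      simp at hcM
    have hdeg : (C c * M - M * C c).degree < P.degree := by
      rw [← hMdeg, ← degree_C_mul (p := M) hc]
      refine degree_sub_lt_left ?_ ?_ ?_
      · rw [degree_C_mul hc, degree_mul_C hc]
      · exact mul_ne_zero (C_ne_zero.2 hc) hMmonic.ne_zero
      · simp [leadingCoeff_mul, hMmonic.leadingCoeff]
    obtain ⟨Q, hQ, hQa, hQdeg⟩ := ih _ hdeg (C c * M - M * C c) (sub_ne_zero.2 hcM) (by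
      intro b hb
      have hb' : c * b * c⁻¹ ∈ conjClass a := by
        obtain ⟨e, he, rfl⟩ := hb
        exact ⟨c * e, mul_ne_zero hc he, by rw [mul_inv_rev]; simp only [mul_assoc]⟩
      rw [eval_sub, eval_C_mul, eval_mul_C_eq_eval_conj_mul M hc, hMvan b hb, hMvan _ hb']
      simp) rfl
    exact ⟨Q, hQ, hQa, hQdeg.trans hdeg.le⟩

theorem commute_map_center {D : Type*} [DivisionRing D] (p : (Subring.center D)[X]) (q : D[X]) :
    Commute (p.map (algebraMap (Subring.center D) D)) q := by
  induction p using Polynomial.induction_on' with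
  | add p₁ p₂ h₁ h₂ => rw [Polynomial.map_add]; exact h₁.add_left h₂
  | monomial n a =>
    rw [map_monomial, ← C_mul_X_pow_eq_monomial]
    refine Commute.mul_left ?_ (commute_X_pow q n)
    ext i
    rw [coeff_C_mul, coeff_mul_C]
    exact (Subring.mem_center_iff.1 a.2 _).symm

/-- If `p = S * (X - C a)` has central coefficients, then also `p = (X - C a) * S`; evaluate this at `b`. -/
theorem aeval_eq_of_map_eq_mul_X_sub_C {D : Type*} [DivisionRing D] {a : D}
    {p : (Subring.center D)[X]} {S : D[X]}
    (hS : p.map (algebraMap (Subring.center D) D) = S * (X - C a)) (b : D) :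
    aeval b p = S.eval b * b - a * S.eval b := by
  have hcomm : S * (X - C a) = (X - C a) * S := by
    refine mul_right_cancel₀ (X_sub_C_ne_zero a) ?_
    rw [← hS, (commute_map_center p (X - C a)).eq, hS, mul_assoc]
  rw [aeval_def, eval₂_eq_eval_map, hS, hcomm, sub_mul, eval_sub, X_mul, eval_mul_X, eval_C_mul]

/-- **Dickson's theorem**: a root of the minimal polynomial of `a` is conjugate to `a`. -/
theorem aeval_minpoly_ne_zero {D : Type*} [DivisionRing D] {a b : D}
    (hdist : conjClass a ≠ conjClass b) (ha : IsIntegral (Subring.center D) a) {S : D[X]}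
    (hS : (minpoly (Subring.center D) a).map (algebraMap (Subring.center D) D)
      = S * (X - C a)) :
    aeval b (minpoly (Subring.center D) a) ≠ 0 := by
  intro hb
  have hmonic := minpoly.monic ha
  have hf : minpoly (Subring.center D) a = minpoly (Subring.center D) b :=
    minpoly.eq_of_irreducible_of_monic (minpoly.irreducible ha) hb hmonic
  have hSne : S ≠ 0 := by
    rintro rfl
    rw [zero_mul] at hS
    exact (hmonic.map _).ne_zero hS
  have hvan : ∀ x ∈ conjClass b, S.eval x = 0 := by
    rintro x ⟨c, hc, rfl⟩
    by_contra hx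
    have hroot : aeval (c * b * c⁻¹) (minpoly (Subring.center D) a) = 0 := by
      have h := eval_mul_C_eq_eval_conj_mul
        ((minpoly (Subring.center D) a).map (algebraMap (Subring.center D) D)) hc b
      rw [(commute_map_center _ (C c)).eq, eval_C_mul, ← eval₂_eq_eval_map,
        ← eval₂_eq_eval_map, ← aeval_def, ← aeval_def, hb, mul_zero] at h
      exact (mul_eq_zero.1 h.symm).resolve_right hc
    rw [aeval_eq_of_map_eq_mul_X_sub_C hS, sub_eq_zero] at hroot
    refine hdist ((conjClass_eq_of_mul_eq hx hroot).trans ?_)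
    exact conjClass_eq_of_mul_eq hc (by simp [hc])
  obtain ⟨Q, hQ, hQb, hQdeg⟩ := exists_central_annihilator b S hSne hvan
  have hle := (minpoly.degree_le_of_ne_zero (Subring.center D) b hQ hQb).trans hQdeg
  have hdeg := congrArg degree hS
  rw [hmonic.degree_map, degree_mul, degree_X_sub_C, hf] at hdeg
  rw [hdeg, degree_eq_natDegree hSne] at hle
  exact absurd hle (by norm_cast; omega)

/-- **Corollary (reordering a product of two linear factors).**
Let `D` be a division ring with center `F`, `d₁, d₂ ∈ D` with `[d₁] ≠ [d₂]` and `d₁`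
algebraic over `F` with minimal polynomial `f(x)`, and let `S(x) ∈ D[x]` satisfy
`f(x) = S(x)·(x − d₁)`.  With `ζ := S(d₂) d₂ (S(d₂))⁻¹` and
`d := (d₁ − ζ) d₁ (d₁ − ζ)⁻¹`, we have `(x − d₂)(x − d₁) = (x − d)(x − ζ)`. -/
theorem swap_linear_factors {D : Type*} [DivisionRing D]
    (d₁ d₂ : D) (hdist : conjClass d₁ ≠ conjClass d₂)
    (h₁ : IsIntegral (Subring.center D) d₁)
    (S : Polynomial D)
    (hS : (minpoly (Subring.center D) d₁).map (algebraMap (Subring.center D) D)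
      = S * (X - C d₁))
    (ζ d : D)
    (hζ : ζ = S.eval d₂ * d₂ * (S.eval d₂)⁻¹)
    (hd : d = (d₁ - ζ) * d₁ * (d₁ - ζ)⁻¹) :
    (X - C d₂) * (X - C d₁) = (X - C d) * (X - C ζ) := by
  have hne := aeval_minpoly_ne_zero hdist h₁ hS
  have hfd := aeval_eq_of_map_eq_mul_X_sub_C hS d₂
  have hs : S.eval d₂ ≠ 0 := fun h => hne (by rw [hfd, h]; simp)
  have hζs : S.eval d₂ * d₂ = ζ * S.eval d₂ := by rw [hζ, inv_mul_cancel_right₀ hs]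
  have hcomm : Commute (aeval d₂ (minpoly (Subring.center D) d₁)) d₂ := by
    simpa using ((commute_X (minpoly (Subring.center D) d₁)).symm.map (aeval d₂))
  rw [hζs, ← sub_mul] at hfd
  have hu : d₁ - ζ ≠ 0 := fun h => hne (by rw [hfd, ← neg_sub d₁ ζ, h]; simp)
  have hswap : (d₁ - ζ) * ζ = d₂ * (d₁ - ζ) := by
    have h := hcomm.eq
    rw [hfd, mul_assoc, hζs, ← mul_assoc, ← mul_assoc] at h
    have h' := mul_right_cancel₀ hs h
    rw [← neg_sub ζ d₁, neg_mul, mul_neg, h']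
  have hdu : d * (d₁ - ζ) = (d₁ - ζ) * d₁ := by rw [hd, inv_mul_cancel_right₀ hu]
  have hsum : d + ζ = d₂ + d₁ := by
    refine mul_right_cancel₀ hu ?_
    rw [add_mul, add_mul, hdu, ← hswap]
    noncomm_ring
  have hprod : d * ζ = d₂ * d₁ := by
    have h1 : d * d₁ - d * ζ = d₁ * d₁ - ζ * d₁ := by rw [← mul_sub, hdu, sub_mul]
    have h2 : d = d₂ + d₁ - ζ := eq_sub_of_add_eq hsum
    have h3 : d * d₁ = d₂ * d₁ + (d₁ * d₁ - ζ * d₁) := by rw [h2]; noncomm_ring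
    rw [h3] at h1
    exact (by simpa [sub_eq_iff_eq_add, add_comm] using h1 : d₂ * d₁ = d * ζ).symm
  have expand : ∀ a b : D, (X - C a) * (X - C b) = X * X - C (a + b) * X + C (a * b) := by
    intro a b
    rw [sub_mul, mul_sub, mul_sub, X_mul_C, C_add, C_mul, add_mul]
    abel
  rw [expand, expand, hsum, hprod]
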